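/- Under the G₁-Assumption, and assuming min_{i≤k} ‖q_iᵀX‖₂ > 0, max_{j>k} ‖q_jᵀX‖₂ > 0, and min_{i≤k} ‖e_iᵀV‖₂ > 0, one has δ_k(Y) ≤ ((max_{j>m} ‖q_jᵀX‖₂)/(max_{j>k} ‖q_jᵀX‖₂)) · Γ_{k,m}(V) · ‖G₁† E_k‖₂ · δ_k(X), where ‖·‖₂ on a matrix denotes the spectral (operator 2-) norm. -/

import Mathlib

open Matrix

namespace ARR

/-- Euclidean norm of the `i`-th row of a matrix. -/
noncomputable def rowNorm {R C : Type*} [Fintype C] (M : Matrix R C ℝ) (i : R) : ℝ :=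
  Real.sqrt (∑ j, M i j ^ 2)

/-- Supremum of `f` over indices satisfying `P`. -/
noncomputable def supOver {n : ℕ} (P : Fin n → Prop) (f : Fin n → ℝ) : ℝ :=
  sSup (f '' {i | P i})

/-- Infimum of `f` over indices satisfying `P`. -/
noncomputable def infOver {n : ℕ} (P : Fin n → Prop) (f : Fin n → ℝ) : ℝ :=
  sInf (f '' {i | P i})

/-- The accuracy measure `δₖ(Z) = max_{i>k} ‖qᵢᵀZ‖ / min_{i≤k} ‖qᵢᵀZ‖`
(indices are 1-based in the paper; here `i > k` means `k ≤ i` for 0-based `i`). -/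
noncomputable def deltaK {n k : ℕ} (Q : Matrix (Fin n) (Fin n) ℝ)
    (Z : Matrix (Fin n) (Fin k) ℝ) : ℝ :=
  supOver (fun i => k ≤ (i : ℕ)) (rowNorm (Qᵀ * Z)) /
    infOver (fun i => (i : ℕ) < k) (rowNorm (Qᵀ * Z))

/-- `Γ_{k,m}(M) = max_{i>m} ‖eᵢᵀM‖ / min_{i≤k} ‖eᵢᵀM‖`. -/
noncomputable def gammaKM {n : ℕ} {C : Type*} [Fintype C] (k m : ℕ)
    (M : Matrix (Fin n) C ℝ) : ℝ :=
  supOver (fun i => m ≤ (i : ℕ)) (rowNorm M) / infOver (fun i => (i : ℕ) < k) (rowNorm M)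

/-- Spectral (operator 2-) norm of a matrix. -/
noncomputable def specNorm {a b : Type*} [Fintype a] [Fintype b] [DecidableEq b]
    (M : Matrix a b ℝ) : ℝ :=
  ‖LinearMap.toContinuousLinearMap (Matrix.toEuclideanLin M)‖

/-- The Vandermonde matrix `V` with `V i j = λᵢ^j`, `0 ≤ j ≤ p`. -/
def vand {n : ℕ} (lam : Fin n → ℝ) (p : ℕ) : Matrix (Fin n) (Fin (p + 1)) ℝ :=
  fun i j => lam i ^ (j : ℕ)

/-- The diagonal of `D`: `Dᵢᵢ = ‖qᵢᵀX‖₂ ⬝ ‖eᵢᵀV‖₂` (the norm of the `i`-th row of `Ĝ`). -/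
noncomputable def dvec {n k : ℕ} (lam : Fin n → ℝ) (p : ℕ) (Q : Matrix (Fin n) (Fin n) ℝ)
    (X : Matrix (Fin n) (Fin k) ℝ) : Fin n → ℝ :=
  fun i => rowNorm (Qᵀ * X) i * rowNorm (vand lam p) i

/-- `G = D† Ĝ`, where `Ĝ = [QᵀX, ΛQᵀX, …, ΛᵖQᵀX]`; the column block index is `j.1`. -/
noncomputable def gmat {n k : ℕ} (lam : Fin n → ℝ) (p : ℕ) (Q : Matrix (Fin n) (Fin n) ℝ)
    (X : Matrix (Fin n) (Fin k) ℝ) : Matrix (Fin n) (Fin (p + 1) × Fin k) ℝ :=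
  fun i j => (dvec lam p Q X i)⁻¹ * (lam i ^ (j.1 : ℕ) * (Qᵀ * X) i j.2)

/-- The augmented matrix `X_p = [X, AX, …, AᵖX]`; the column block index is `j.1`. -/
noncomputable def aug {n k : ℕ} (A : Matrix (Fin n) (Fin n) ℝ)
    (X : Matrix (Fin n) (Fin k) ℝ) (p : ℕ) : Matrix (Fin n) (Fin (p + 1) × Fin k) ℝ :=
  fun i j => (A ^ (j.1 : ℕ) * X) i j.2

/-- First `m` rows of a matrix. -/
def topRows {n : ℕ} {C : Type*} (m : ℕ) (hmn : m ≤ n) (M : Matrix (Fin n) C ℝ) :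
    Matrix (Fin m) C ℝ :=
  fun i j => M (Fin.castLE hmn i) j

/-- Last `n - m` rows of a matrix. -/
def lowRows {n : ℕ} {C : Type*} (m : ℕ) (hmn : m ≤ n) (M : Matrix (Fin n) C ℝ) :
    Matrix (Fin (n - m)) C ℝ :=
  fun i j => M ⟨m + (i : ℕ), by have := i.isLt; omega⟩ j

/-- First `m` columns of a square matrix (`Q_m`). -/
def colsTop {n : ℕ} (m : ℕ) (hmn : m ≤ n) (M : Matrix (Fin n) (Fin n) ℝ) :
    Matrix (Fin n) (Fin m) ℝ :=
  fun i j => M i (Fin.castLE hmn j)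

/-- Last `n - m` columns of a square matrix (`Q_{m+}`). -/
def colsLow {n : ℕ} (m : ℕ) (hmn : m ≤ n) (M : Matrix (Fin n) (Fin n) ℝ) :
    Matrix (Fin n) (Fin (n - m)) ℝ :=
  fun i j => M i ⟨m + (j : ℕ), by have := j.isLt; omega⟩

/-- `E_k`: the first `k` columns of the `m × m` identity matrix. -/
def ekMat (m k : ℕ) : Matrix (Fin m) (Fin k) ℝ :=
  fun i j => if (i : ℕ) = (j : ℕ) then 1 else 0

/-- `D₁⁻¹`: the inverse of the leading `m × m` block of `D`. -/
noncomputable def d1inv {n : ℕ} (m : ℕ) (hmn : m ≤ n) (d : Fin n → ℝ) :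
    Matrix (Fin m) (Fin m) ℝ :=
  Matrix.diagonal fun i => (d (Fin.castLE hmn i))⁻¹

/-- `D₂`: the trailing `(n-m) × (n-m)` block of `D`. -/
noncomputable def d2mat {n : ℕ} (m : ℕ) (hmn : m ≤ n) (d : Fin n → ℝ) :
    Matrix (Fin (n - m)) (Fin (n - m)) ℝ :=
  Matrix.diagonal fun i => d ⟨m + (i : ℕ), by have := i.isLt; omega⟩

/-- `Y = X_p G₁† D₁⁻¹ E_k`, where `A = Q Λ Qᵀ` and `X_p = [X, AX, …, AᵖX]`. -/
noncomputable def ymat {n k : ℕ} (m : ℕ) (hmn : m ≤ n) (lam : Fin n → ℝ) (p : ℕ)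
    (Q : Matrix (Fin n) (Fin n) ℝ) (X : Matrix (Fin n) (Fin k) ℝ)
    (Gpinv : Matrix (Fin (p + 1) × Fin k) (Fin m) ℝ) : Matrix (Fin n) (Fin k) ℝ :=
  aug (Q * Matrix.diagonal lam * Qᵀ) X p * Gpinv * d1inv m hmn (dvec lam p Q X) * ekMat m k

end ARR

namespace ARR

theorem rowNorm_eq_norm {R C : Type*} [Fintype C] (M : Matrix R C ℝ) (i : R) :
    rowNorm M i = ‖WithLp.toLp 2 (M i)‖ := by
  simp [rowNorm, EuclideanSpace.norm_eq]

theorem rowNorm_nonneg {R C : Type*} [Fintype C] (M : Matrix R C ℝ) (i : R) :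
    0 ≤ rowNorm M i := Real.sqrt_nonneg _

theorem specNorm_nonneg {a b : Type*} [Fintype a] [Fintype b] [DecidableEq b]
    (M : Matrix a b ℝ) : 0 ≤ specNorm M := norm_nonneg _

theorem sq_rowNorm {R C : Type*} [Fintype C] (M : Matrix R C ℝ) (i : R) :
    rowNorm M i ^ 2 = ∑ j, M i j ^ 2 :=
  Real.sq_sqrt (Finset.sum_nonneg fun _ _ => sq_nonneg _)

theorem rowNorm_mul_le {R a b : Type*} [Fintype a] [Fintype b] [DecidableEq b]
    (M : Matrix R a ℝ) (N : Matrix a b ℝ) (i : R) :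
    rowNorm (M * N) i ≤ rowNorm M i * specNorm N := by
  set w : EuclideanSpace ℝ b := WithLp.toLp 2 ((M * N) i) with hw
  have hop : ‖Matrix.toEuclideanLin N w‖ ≤ specNorm N * ‖w‖ :=
    (LinearMap.toContinuousLinearMap (Matrix.toEuclideanLin N)).le_opNorm w
  have hinner : rowNorm (M * N) i ^ 2 =
      inner ℝ (WithLp.toLp 2 (M i)) (Matrix.toEuclideanLin N w) := by
    have hdot : rowNorm (M * N) i ^ 2 = (M i ᵥ* N) ⬝ᵥ (M * N) i := by
      rw [sq_rowNorm]
      simp only [dotProduct, sq]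
      rfl
    rw [hdot, ← Matrix.dotProduct_mulVec, dotProduct_comm]
    simp [hw, EuclideanSpace.inner_eq_star_dotProduct, Matrix.toLpLin_apply]
  have hcs := (hinner.trans_le (real_inner_le_norm _ _)).trans
    (mul_le_mul_of_nonneg_left hop (norm_nonneg _))
  rw [hw, ← rowNorm_eq_norm, ← rowNorm_eq_norm] at hcs
  rcases (rowNorm_nonneg (M * N) i).eq_or_lt with h | h
  · rw [← h]
    exact mul_nonneg (rowNorm_nonneg _ _) (specNorm_nonneg _)
  · refine le_of_mul_le_mul_right ?_ h
    linarith

theorem rowNorm_le_mul {R C : Type*} [Fintype C] {M N : Matrix R C ℝ} {i : R} {c : ℝ}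
    (hc : 0 ≤ c) (h : ∀ j, |M i j| ≤ c * |N i j|) : rowNorm M i ≤ c * rowNorm N i := by
  refine Real.sqrt_le_iff.2 ⟨mul_nonneg hc (rowNorm_nonneg _ _), ?_⟩
  rw [mul_pow, sq_rowNorm, Finset.mul_sum]
  refine Finset.sum_le_sum fun j _ => ?_
  rw [← sq_abs (M i j), ← sq_abs (N i j), ← mul_pow]
  exact pow_le_pow_left₀ (abs_nonneg _) (h j) 2

theorem le_supOver {n : ℕ} {P : Fin n → Prop} (f : Fin n → ℝ) {i : Fin n} (hi : P i) :
    f i ≤ supOver P f :=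
  le_csSup (Set.toFinite _).bddAbove ⟨i, hi, rfl⟩

theorem infOver_le {n : ℕ} {P : Fin n → Prop} (f : Fin n → ℝ) {i : Fin n} (hi : P i) :
    infOver P f ≤ f i :=
  csInf_le (Set.toFinite _).bddBelow ⟨i, hi, rfl⟩

theorem supOver_le {n : ℕ} {P : Fin n → Prop} {f : Fin n → ℝ} {c : ℝ} (hc : 0 ≤ c)
    (h : ∀ i, P i → f i ≤ c) : supOver P f ≤ c :=
  Real.sSup_le (by rintro _ ⟨i, hi, rfl⟩; exact h i hi) hc

theorem supOver_nonneg {n : ℕ} (P : Fin n → Prop) {f : Fin n → ℝ} (hf : ∀ i, 0 ≤ f i) :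
    0 ≤ supOver P f :=
  Real.sSup_nonneg (by rintro _ ⟨i, _, rfl⟩; exact hf i)

theorem infOver_eq_of_forall {n : ℕ} {P : Fin n → Prop} {f : Fin n → ℝ} {c : ℝ}
    (hP : ∃ i, P i) (h : ∀ i, P i → f i = c) : infOver P f = c := by
  obtain ⟨i, hi⟩ := hP
  refine le_antisymm ((infOver_le f hi).trans_eq (h i hi)) (le_csInf ⟨_, i, hi, rfl⟩ ?_)
  rintro _ ⟨j, hj, rfl⟩
  exact (h j hj).ge

theorem conj_diagonal_pow {n : ℕ} (lam : Fin n → ℝ) {Q : Matrix (Fin n) (Fin n) ℝ}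
    (hQ : Q * Qᵀ = 1) (hQ' : Qᵀ * Q = 1) (l : ℕ) :
    (Q * Matrix.diagonal lam * Qᵀ) ^ l = Q * Matrix.diagonal (lam ^ l) * Qᵀ := by
  induction l with
  | zero => simp [hQ]
  | succ l ih =>
    calc (Q * Matrix.diagonal lam * Qᵀ) ^ (l + 1)
        = Q * Matrix.diagonal (lam ^ l) * (Qᵀ * Q) * Matrix.diagonal lam * Qᵀ := by
          rw [pow_succ, ih]; simp only [Matrix.mul_assoc]
      _ = Q * (Matrix.diagonal (lam ^ l) * Matrix.diagonal lam) * Qᵀ := by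
          rw [hQ']; simp only [Matrix.mul_assoc, Matrix.one_mul]
      _ = _ := by rw [Matrix.diagonal_mul_diagonal, pow_succ]; rfl

theorem transpose_mul_aug_apply {n k : ℕ} (lam : Fin n → ℝ) {Q : Matrix (Fin n) (Fin n) ℝ}
    (hQ : Q * Qᵀ = 1) (hQ' : Qᵀ * Q = 1) (X : Matrix (Fin n) (Fin k) ℝ) (p : ℕ)
    (i : Fin n) (j : Fin (p + 1) × Fin k) :
    (Qᵀ * aug (Q * Matrix.diagonal lam * Qᵀ) X p) i j =
      lam i ^ (j.1 : ℕ) * (Qᵀ * X) i j.2 := by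
  calc (Qᵀ * aug (Q * Matrix.diagonal lam * Qᵀ) X p) i j
      = (Qᵀ * ((Q * Matrix.diagonal lam * Qᵀ) ^ (j.1 : ℕ) * X)) i j.2 := rfl
    _ = ((Qᵀ * Q) * (Matrix.diagonal (lam ^ (j.1 : ℕ)) * (Qᵀ * X))) i j.2 := by
        rw [conj_diagonal_pow lam hQ hQ']; simp only [Matrix.mul_assoc]
    _ = _ := by rw [hQ', Matrix.one_mul, Matrix.diagonal_mul]; rfl

theorem dvec_nonneg {n k : ℕ} (lam : Fin n → ℝ) (p : ℕ) (Q : Matrix (Fin n) (Fin n) ℝ)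
    (X : Matrix (Fin n) (Fin k) ℝ) (i : Fin n) : 0 ≤ dvec lam p Q X i :=
  mul_nonneg (rowNorm_nonneg _ _) (rowNorm_nonneg _ _)

theorem sq_dvec {n k : ℕ} (lam : Fin n → ℝ) (p : ℕ) (Q : Matrix (Fin n) (Fin n) ℝ)
    (X : Matrix (Fin n) (Fin k) ℝ) (i : Fin n) :
    dvec lam p Q X i ^ 2 =
      ∑ j : Fin (p + 1) × Fin k, (lam i ^ (j.1 : ℕ) * (Qᵀ * X) i j.2) ^ 2 := by
  rw [dvec, mul_pow, sq_rowNorm, sq_rowNorm, mul_comm, Finset.sum_mul_sum,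
    Fintype.sum_prod_type]
  simp only [vand, mul_pow]

theorem rowNorm_gmat_le_one {n k : ℕ} (lam : Fin n → ℝ) (p : ℕ)
    (Q : Matrix (Fin n) (Fin n) ℝ) (X : Matrix (Fin n) (Fin k) ℝ) (i : Fin n) :
    rowNorm (gmat lam p Q X) i ≤ 1 := by
  refine Real.sqrt_le_one.2 ?_
  simp only [gmat, mul_pow _ (_ * _)]
  rw [← Finset.mul_sum, ← sq_dvec, ← mul_pow]
  exact pow_le_one₀ (mul_nonneg (inv_nonneg.2 (dvec_nonneg ..)) (dvec_nonneg ..))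
    inv_mul_le_one

theorem transpose_mul_aug {n k : ℕ} (lam : Fin n → ℝ) {Q : Matrix (Fin n) (Fin n) ℝ}
    (hQ : Q * Qᵀ = 1) (hQ' : Qᵀ * Q = 1) (X : Matrix (Fin n) (Fin k) ℝ) (p : ℕ) :
    Qᵀ * aug (Q * Matrix.diagonal lam * Qᵀ) X p =
      Matrix.diagonal (dvec lam p Q X) * gmat lam p Q X := by
  ext i j
  rw [transpose_mul_aug_apply lam hQ hQ', Matrix.diagonal_mul, gmat]
  by_cases hd : dvec lam p Q X i = 0
  · have hsum := sq_dvec lam p Q X i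
    rw [hd, zero_pow two_ne_zero, eq_comm,
      Finset.sum_eq_zero_iff_of_nonneg fun _ _ => sq_nonneg _] at hsum
    rw [hd, zero_mul]
    exact pow_eq_zero_iff two_ne_zero |>.1 (hsum j (Finset.mem_univ j))
  · rw [mul_inv_cancel_left₀ hd]

theorem mul_ekMat_apply {R : Type*} {m k : ℕ} (hkm : k ≤ m) (M : Matrix R (Fin m) ℝ)
    (i : R) (j : Fin k) : (M * ekMat m k) i j = M i (Fin.castLE hkm j) := by
  rw [Matrix.mul_apply, Finset.sum_eq_single (Fin.castLE hkm j)]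
  · simp [ekMat]
  · intro l _ hl
    have : (l : ℕ) ≠ j := fun h => hl (Fin.ext h)
    simp [ekMat, this]
  · simp

theorem transpose_mul_ymat_apply {n k p m : ℕ} (hkm : k ≤ m) (hmn : m ≤ n)
    (lam : Fin n → ℝ) {Q : Matrix (Fin n) (Fin n) ℝ} (hQ : Q * Qᵀ = 1) (hQ' : Qᵀ * Q = 1)
    (X : Matrix (Fin n) (Fin k) ℝ) (Gpinv : Matrix (Fin (p + 1) × Fin k) (Fin m) ℝ)
    (i : Fin n) (j : Fin k) :
    (Qᵀ * ymat m hmn lam p Q X Gpinv) i j =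
      dvec lam p Q X i * (dvec lam p Q X (Fin.castLE (hkm.trans hmn) j))⁻¹ *
        (gmat lam p Q X * (Gpinv * ekMat m k)) i j := by
  rw [ymat, ← Matrix.mul_assoc, mul_ekMat_apply hkm, ← Matrix.mul_assoc, d1inv,
    Matrix.mul_diagonal, ← Matrix.mul_assoc, transpose_mul_aug lam hQ hQ', Matrix.mul_assoc,
    Matrix.diagonal_mul, ← Matrix.mul_assoc, mul_ekMat_apply hkm, Fin.castLE_castLE]
  ring

theorem gmat_mul_apply_of_lt {n k p m : ℕ} (hmn : m ≤ n)
    {lam : Fin n → ℝ} {Q : Matrix (Fin n) (Fin n) ℝ} {X : Matrix (Fin n) (Fin k) ℝ}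
    {Gpinv : Matrix (Fin (p + 1) × Fin k) (Fin m) ℝ}
    (hG1 : topRows m hmn (gmat lam p Q X) * Gpinv = 1)
    {i : Fin n} (hi : (i : ℕ) < m) (j : Fin k) :
    (gmat lam p Q X * (Gpinv * ekMat m k)) i j = if (i : ℕ) = j then 1 else 0 := by
  calc (gmat lam p Q X * (Gpinv * ekMat m k)) i j
      = (topRows m hmn (gmat lam p Q X) * (Gpinv * ekMat m k)) ⟨i, hi⟩ j := rfl
    _ = _ := by rw [← Matrix.mul_assoc, hG1, Matrix.one_mul]; rfl

end ARR

open ARR in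
/-- second part of Theorem 3.1 of the paper. Under the `G₁`-Assumption,
`δₖ(Y) ≤ (max_{j>m}‖qⱼᵀX‖ / max_{j>k}‖qⱼᵀX‖) ⬝ Γ_{k,m}(V) ⬝ ‖G₁† E_k‖₂ ⬝ δₖ(X)`. -/
theorem arr_thm1_part2 {n k p m : ℕ} (hk : 0 < k) (hn : (p + 1) * k < n)
    (hkm : k ≤ m) (hmk : m ≤ k + p * k) (hmn : m ≤ n)
    (lam : Fin n → ℝ) (hlam : Antitone lam)
    (Q : Matrix (Fin n) (Fin n) ℝ) (hQ : Q * Qᵀ = 1) (hQ' : Qᵀ * Q = 1)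
    (X : Matrix (Fin n) (Fin k) ℝ)
    (Gpinv : Matrix (Fin (p + 1) × Fin k) (Fin m) ℝ)
    (hG1 : topRows m hmn (gmat lam p Q X) * Gpinv = 1)
    (hX : 0 < infOver (fun i => (i : ℕ) < k) (rowNorm (Qᵀ * X)))
    (hXk : 0 < supOver (fun j => k ≤ (j : ℕ)) (rowNorm (Qᵀ * X)))
    (hV : 0 < infOver (fun i => (i : ℕ) < k) (rowNorm (vand lam p))) :
    deltaK Q (ymat m hmn lam p Q X Gpinv) ≤
      (supOver (fun j => m ≤ (j : ℕ)) (rowNorm (Qᵀ * X)) /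
          supOver (fun j => k ≤ (j : ℕ)) (rowNorm (Qᵀ * X))) *
        gammaKM k m (vand lam p) * specNorm (Gpinv * ekMat m k) * deltaK Q X := by
  have hkn : k ≤ n := hkm.trans hmn
  set f := rowNorm (Qᵀ * X)
  set g := rowNorm (vand lam p)
  set d := dvec lam p Q X with hd
  set a := infOver (fun i : Fin n => (i : ℕ) < k) f
  set b := infOver (fun i : Fin n => (i : ℕ) < k) g
  set S := supOver (fun j : Fin n => k ≤ (j : ℕ)) f
  set F := supOver (fun j : Fin n => m ≤ (j : ℕ)) f
  set H := supOver (fun j : Fin n => m ≤ (j : ℕ)) g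
  set s := specNorm (Gpinv * ekMat m k)
  have hF0 : 0 ≤ F := supOver_nonneg _ (rowNorm_nonneg _)
  have hH0 : 0 ≤ H := supOver_nonneg _ (rowNorm_nonneg _)
  have hs0 : 0 ≤ s := specNorm_nonneg _
  have hdlow : ∀ i : Fin n, (i : ℕ) < k → a * b ≤ d i := fun i hi =>
    mul_le_mul (infOver_le f hi) (infOver_le g hi) hV.le (rowNorm_nonneg _ _)
  have hab : 0 < a * b := mul_pos hX hV
  have hentry := transpose_mul_ymat_apply hkm hmn lam hQ hQ' X Gpinv
  have hinf : infOver (fun i => (i : ℕ) < k)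
      (rowNorm (Qᵀ * ymat m hmn lam p Q X Gpinv)) = 1 := by
    refine infOver_eq_of_forall ⟨⟨0, hk.trans_le hkn⟩, hk⟩ fun i hi => ?_
    have hrow : ∀ j : Fin k, (Qᵀ * ymat m hmn lam p Q X Gpinv) i j =
        if j = ⟨i, hi⟩ then 1 else 0 := by
      intro j
      rw [hentry, gmat_mul_apply_of_lt hmn hG1 (hi.trans_le hkm)]
      by_cases hij : j = ⟨i, hi⟩
      · subst hij
        have : d i ≠ 0 := (hab.trans_le (hdlow i hi)).ne'
        simp [← hd, this]
      · have : (i : ℕ) ≠ j := fun h => hij (Fin.ext h.symm)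
        simp [hij, this]
    simp [rowNorm, hrow]
  have hsup : supOver (fun i => k ≤ (i : ℕ))
      (rowNorm (Qᵀ * ymat m hmn lam p Q X Gpinv)) ≤ F * H * (a * b)⁻¹ * s := by
    have hc : 0 ≤ F * H * (a * b)⁻¹ := by positivity
    refine supOver_le (mul_nonneg hc hs0) fun i hi => ?_
    rcases lt_or_ge (i : ℕ) m with him | him
    · have hrow : ∀ j : Fin k, (Qᵀ * ymat m hmn lam p Q X Gpinv) i j = 0 := by
        intro j
        have : (i : ℕ) ≠ j := (j.isLt.trans_le hi).ne'
        rw [hentry, gmat_mul_apply_of_lt hmn hG1 him, if_neg this, mul_zero]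
      simpa [rowNorm, hrow] using mul_nonneg hc hs0
    · have hgs : rowNorm (gmat lam p Q X * (Gpinv * ekMat m k)) i ≤ s :=
        (rowNorm_mul_le _ _ i).trans
          (mul_le_of_le_one_left hs0 (rowNorm_gmat_le_one lam p Q X i))
      refine le_trans (rowNorm_le_mul hc fun j => ?_) (mul_le_mul_of_nonneg_left hgs hc)
      have hdj := hdlow (Fin.castLE hkn j) j.isLt
      have hdi : d i ≤ F * H :=
        mul_le_mul (le_supOver f him) (le_supOver g him) (rowNorm_nonneg _ _) hF0
      have hd0 : ∀ i, 0 ≤ d i := dvec_nonneg lam p Q X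
      rw [hentry, abs_mul, abs_of_nonneg (mul_nonneg (hd0 _) (inv_nonneg.2 (hd0 _)))]
      exact mul_le_mul_of_nonneg_right
        (mul_le_mul hdi (inv_anti₀ hab hdj) (inv_nonneg.2 (hd0 _)) (mul_nonneg hF0 hH0))
        (abs_nonneg _)
  rw [deltaK, hinf, div_one]
  refine hsup.trans_eq ?_
  rw [gammaKM, deltaK]
  change _ = F / S * (H / b) * s * (S / a)
  field_simp
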